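/- The second Rogers–Ramanujan identity: Let q be a complex number with |q| < 1. Then ∑_{n=0}^∞ q^{n²+n} / (q;q)_n = ∏_{n=0}^∞ 1 / ((1 − q^{5n+2})(1 − q^{5n+3})). -/

import Mathlib

/-- The finite q-Pochhammer symbol `(a; q)_k = ∏_{i=0}^{k-1} (1 - a q^i)`. -/
noncomputable def qPoch (q a : ℂ) (k : ℕ) : ℂ := ∏ i ∈ Finset.range k, (1 - a * q ^ i)

open Finset

/-- reciprocal of `(q;q)_n` -/
noncomputable def pinv (q : ℂ) (n : ℕ) : ℂ := (qPoch q q n)⁻¹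

/-- `1/(q;q)_(N-r)`, zero if `r > N` -/
noncomputable def pp (q : ℂ) (N r : ℕ) : ℂ := if r ≤ N then pinv q (N - r) else 0

noncomputable def bb (q : ℂ) (N r : ℕ) : ℂ := pp q N r * pinv q (N + r + 1)

noncomputable def cc (z w : ℂ) : ℕ → ℂ
  | 0 => 1
  | r + 1 => - z ^ r * w ^ (r + 1) * cc z w r

noncomputable def dd (z w : ℂ) (r : ℕ) : ℂ := cc z w r * (1 - z ^ (2 * r + 1))

lemma one_sub_pow_ne {q : ℂ} (hq : ‖q‖ < 1) (n : ℕ) : 1 - q ^ (n + 1) ≠ 0 := by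
  intro h
  have h1 : q ^ (n + 1) = 1 := (sub_eq_zero.mp h).symm
  have h2 : ‖q‖ ^ (n + 1) = 1 := by rw [← norm_pow, h1, norm_one]
  have := pow_lt_one₀ (norm_nonneg q) hq (Nat.succ_ne_zero n)
  exact absurd h2 this.ne

lemma qPoch_succ (q a : ℂ) (n : ℕ) : qPoch q a (n + 1) = qPoch q a n * (1 - a * q ^ n) := by
  simp [qPoch, prod_range_succ]

lemma qPoch_zero (q a : ℂ) : qPoch q a 0 = 1 := by simp [qPoch]

lemma pinv_zero (q : ℂ) : pinv q 0 = 1 := by simp [pinv, qPoch_zero]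

lemma pinv_step {q : ℂ} (hq : ‖q‖ < 1) (n : ℕ) :
    pinv q n = pinv q (n + 1) * (1 - q ^ (n + 1)) := by
  have h := one_sub_pow_ne hq n
  rw [pinv, pinv, qPoch_succ, ← pow_succ', mul_inv, mul_assoc, inv_mul_cancel₀ h, mul_one]

lemma qPoch_ne {q : ℂ} (hq : ‖q‖ < 1) (n : ℕ) : qPoch q q n ≠ 0 := by
  refine prod_ne_zero_iff.mpr fun i _ => ?_
  rw [← pow_succ']
  exact one_sub_pow_ne hq i

lemma pp_add (q : ℂ) (r n : ℕ) : pp q (r + n) r = pinv q n := by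
  simp [pp]

lemma pp_gt (q : ℂ) {N r : ℕ} (h : N < r) : pp q N r = 0 := by
  simp [pp, h]

lemma bb_gt (q : ℂ) {N r : ℕ} (h : N < r) : bb q N r = 0 := by
  simp [bb, pp_gt q h]

/-- right shift -/
lemma pp_shift {q : ℂ} (hq : ‖q‖ < 1) (r n : ℕ) :
    pp q (r + n) (r + 1) = pinv q n * (1 - q ^ n) := by
  cases n with
  | zero => simp [pp]
  | succ n =>
    rw [show r + (n + 1) = (r + 1) + n by ring, pp_add, pinv_step hq]

lemma bb_rec_zero {q : ℂ} (hq : ‖q‖ < 1) (N : ℕ) :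
    (1 - q ^ (2 * N + 2)) * (1 - q ^ (2 * N + 3)) * bb q (N + 1) 0 =
      q ^ (N + 1) * bb q N 0 + (1 + q ^ (2 * N + 2)) * bb q N 0
        + q ^ (N + 2) * bb q N 1 := by
  have h1 := pp_add q 0 (N + 1)
  have h2 := pp_add q 0 N
  have h3 := pp_shift hq 0 N
  simp only [zero_add] at h1 h2 h3
  simp only [bb, h1, h2, h3, add_zero]
  have e1 := pinv_step hq N
  have e2 := pinv_step hq (N + 1)
  rw [show N + 1 + 1 = N + 2 by ring] at *
  rw [e1, e2]
  ring

lemma bb_rec_succ {q : ℂ} (hq : ‖q‖ < 1) (r n : ℕ) :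
    (1 - q ^ (2 * (r + 1 + n) + 2)) * (1 - q ^ (2 * (r + 1 + n) + 3)) * bb q (r + 1 + n + 1) (r + 1) =
      q ^ (n + 1) * bb q (r + 1 + n) r + (1 + q ^ (2 * (r + 1 + n) + 2)) * bb q (r + 1 + n) (r + 1)
        + q ^ (2 * r + n + 4) * bb q (r + 1 + n) (r + 2) := by
  have h1 := pp_add q (r + 1) (n + 1)
  have h2 := pp_add q (r + 1) n
  have h3 := pp_shift hq (r + 1) n
  have h4 := pp_add q r (n + 1)
  rw [show r + (n + 1) = r + 1 + n by ring] at h4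
  rw [show r + 1 + (n + 1) = r + 1 + n + 1 by ring] at h1
  rw [show r + 1 + 1 = r + 2 by ring] at h3
  simp only [bb, h1, h2, h3, h4]
  have e1 := pinv_step hq n
  have e2 := pinv_step hq (2 * r + n + 2)
  have e3 := pinv_step hq (2 * r + n + 3)
  rw [show r + 1 + n + 1 + (r + 1) + 1 = 2 * r + n + 3 + 1 by ring,
    show r + 1 + n + r + 1 = 2 * r + n + 2 by ring,
    show r + 1 + n + (r + 1) + 1 = 2 * r + n + 2 + 1 by ring,
    show r + 1 + n + (r + 2) + 1 = 2 * r + n + 3 + 1 by ring, e2, e3, e1]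
  ring

lemma bb_rec_last {q : ℂ} (hq : ‖q‖ < 1) (N : ℕ) :
    (1 - q ^ (2 * N + 2)) * (1 - q ^ (2 * N + 3)) * bb q (N + 1) (N + 1) = bb q N N := by
  have h1 := pp_add q (N + 1) 0
  have h2 := pp_add q N 0
  simp only [add_zero] at h1 h2
  simp only [bb, h1, h2]
  have e2 := pinv_step hq (2 * N + 1)
  have e3 := pinv_step hq (2 * N + 2)
  rw [show N + 1 + (N + 1) + 1 = 2 * N + 2 + 1 by ring,
    show N + N + 1 = 2 * N + 1 by ring, e2, e3]
  ring

/-- Finite Jacobi triple product -/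
lemma finite_jtp {z w : ℂ} (hq : ‖z * w‖ < 1) (N : ℕ) :
    ∑ r ∈ range (N + 1), dd z w r * bb (z * w) N r =
      qPoch (z * w) z (N + 1) * qPoch (z * w) w N * pinv (z * w) (2 * N + 1) := by
  induction N with
  | zero =>
    simp [dd, cc, bb, qPoch, pp, pinv_zero]
  | succ N ih =>
    set Q := z * w with hQ
    have hne : (1 - Q ^ (2 * N + 2)) * (1 - Q ^ (2 * N + 3)) ≠ 0 :=
      mul_ne_zero (one_sub_pow_ne hq _) (one_sub_pow_ne hq _)
    apply mul_left_cancel₀ hne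
    have key : (1 - Q ^ (2 * N + 2)) * (1 - Q ^ (2 * N + 3)) *
        ∑ r ∈ range (N + 1 + 1), dd z w r * bb Q (N + 1) r =
        (1 - z * Q ^ (N + 1)) * (1 - w * Q ^ N) * ∑ r ∈ range (N + 1), dd z w r * bb Q N r := by
      -- telescoping: X r = d_{r+1} Q^{N-r} b_r - d_r Q^{N+2+r} b_{r+1}
      have tel : ∀ M, M ≤ N →
          (1 - Q ^ (2 * N + 2)) * (1 - Q ^ (2 * N + 3)) *
            ∑ r ∈ range (M + 1), dd z w r * bb Q (N + 1) r =
          (1 - z * Q ^ (N + 1)) * (1 - w * Q ^ N) * ∑ r ∈ range (M + 1), dd z w r * bb Q N r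
           - dd z w (M + 1) * Q ^ (N - M) * bb Q N M + dd z w M * Q ^ (N + 2 + M) * bb Q N (M + 1) := by
        intro M
        induction M with
        | zero =>
          intro _
          have := bb_rec_zero hq N
          simp only [zero_add, range_one, sum_singleton, Nat.sub_zero, add_zero]
          linear_combination dd z w 0 * this + bb Q N 0 * (by
            simp only [dd, cc, hQ]; ring :
            dd z w 1 * Q ^ N + dd z w 0 * Q ^ (N + 1) = -(z * Q ^ (N + 1) + w * Q ^ N) * dd z w 0)
            + bb Q N 0 * dd z w 0 * (by rw [hQ]; ring : Q ^ (2 * N + 2) - z * w * Q ^ (2 * N + 1) = 0)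
        | succ r ihr =>
          intro hr
          obtain ⟨n, rfl⟩ := Nat.exists_eq_add_of_le hr
          have i1 := ihr (by omega)
          have := bb_rec_succ hq r n
          rw [sum_range_succ _ (r + 1), sum_range_succ _ (r + 1)]
          rw [show r + 1 + n - r = n + 1 by omega] at i1
          rw [show r + 1 + n - (r + 1) = n by omega]
          simp only [show r + 1 + 1 = r + 2 by ring]
          have e : dd z w (r + 2) * Q ^ n + dd z w r * Q ^ (2 * r + n + 3) =
             -(z * Q ^ (r + 1 + n + 1) + w * Q ^ (r + 1 + n)) * dd z w (r + 1) := by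
            simp only [dd, cc, hQ]; ring
          have e2 : Q ^ (2 * (r + 1 + n) + 2) - z * w * Q ^ (2 * (r + 1 + n) + 1) = 0 := by
            rw [hQ]; ring
          linear_combination i1 + dd z w (r + 1) * this + bb Q (r + 1 + n) (r + 1) * e
            + bb Q (r + 1 + n) (r + 1) * dd z w (r + 1) * e2
      have h := tel N le_rfl
      rw [sum_range_succ _ (N + 1), mul_add, h, bb_gt Q (Nat.lt_succ_self N)]
      have := bb_rec_last hq N
      simp only [Nat.sub_self]
      linear_combination dd z w (N + 1) * this
    rw [key, ih]
    have e1 := pinv_step hq (2 * N + 1)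
    have e2 := pinv_step hq (2 * N + 2)
    rw [qPoch_succ Q z (N + 1), qPoch_succ Q w N, e1, e2]
    rw [show 2 * (N + 1) + 1 = 2 * N + 2 + 1 by ring]
    ring

/-- Gaussian binomials -/
noncomputable def gb (q : ℂ) : ℕ → ℕ → ℂ
  | _, 0 => 1
  | 0, _ + 1 => 0
  | n + 1, j + 1 => gb q n j + q ^ (j + 1) * gb q n (j + 1)

lemma gb_gt (q : ℂ) : ∀ (n j : ℕ), n < j → gb q n j = 0
  | 0, 0, h => by omega
  | 0, j + 1, _ => by simp [gb]
  | n + 1, 0, h => by omega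
  | n + 1, j + 1, h => by
    rw [gb, gb_gt q n j (by omega), gb_gt q n (j + 1) (by omega)]; ring

lemma gb_eq {q : ℂ} (hq : ‖q‖ < 1) (n : ℕ) : ∀ j, gb q n j = qPoch q q n * pinv q j * pp q n j := by
  induction n with
  | zero =>
    intro j
    cases j with
    | zero => simp [gb, qPoch_zero, pinv_zero, pp]
    | succ j => simp [gb, pp]
  | succ n ih =>
    intro j
    cases j with
    | zero =>
      simp [gb, pinv_zero, pp]
      rw [pinv, mul_inv_cancel₀ (qPoch_ne hq _)]
    | succ j =>
      rw [gb, ih, ih]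
      rcases lt_or_ge n j with h | h
      · rw [pp_gt q h, pp_gt q (show n < j + 1 by omega), pp_gt q (show n + 1 < j + 1 by omega)]
        ring
      · obtain ⟨m, rfl⟩ := Nat.exists_eq_add_of_le h
        have h1 := pp_add q (j + 1) m
        rw [show j + 1 + m = j + m + 1 by ring] at h1
        rw [h1, pp_add, pp_shift hq, qPoch_succ, ← pow_succ', pinv_step hq j]
        ring

lemma gb_sum {q : ℂ} (hq : ‖q‖ < 1) (n : ℕ) : ∀ m,
    ∑ j ∈ range (n + 1), gb q n j * q ^ (j ^ 2 + m * j) * pinv q (j + m) = pinv q (n + m) := by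
  induction n with
  | zero => intro m; simp [gb]
  | succ n ih =>
    intro m
    rw [show n + 1 + m = n + (m + 1) by ring, ← ih (m + 1), sum_range_succ']
    have hz : ∑ j ∈ range (n + 1), q ^ (j + 1) * gb q n (j + 1) * q ^ ((j + 1) ^ 2 + m * (j + 1))
        * pinv q (j + 1 + m) + pinv q m =
        ∑ j ∈ range (n + 1), q ^ j * gb q n j * q ^ (j ^ 2 + m * j) * pinv q (j + m) := by
      rw [sum_range_succ' (fun j => q ^ j * gb q n j * q ^ (j ^ 2 + m * j) * pinv q (j + m)),
        sum_range_succ, gb_gt q n (n + 1) (by omega)]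
      simp [gb]
    have hs : ∑ j ∈ range (n + 1), gb q (n + 1) (j + 1) * q ^ ((j + 1) ^ 2 + m * (j + 1))
        * pinv q (j + 1 + m) =
        ∑ j ∈ range (n + 1), gb q n j * q ^ ((j + 1) ^ 2 + m * (j + 1)) * pinv q (j + 1 + m)
        + ∑ j ∈ range (n + 1), q ^ (j + 1) * gb q n (j + 1) * q ^ ((j + 1) ^ 2 + m * (j + 1))
        * pinv q (j + 1 + m) := by
      rw [← sum_add_distrib]
      refine sum_congr rfl fun j _ => ?_
      rw [gb]; ring
    rw [hs]
    have h0 : gb q (n + 1) 0 * q ^ (0 ^ 2 + m * 0) * pinv q (0 + m) = pinv q m := by simp [gb]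
    rw [h0, add_assoc, hz, ← sum_add_distrib]
    refine sum_congr rfl fun j _ => ?_
    have e := pinv_step hq (j + m)
    rw [show j + 1 + m = j + m + 1 by ring, show j + (m + 1) = j + m + 1 by ring, e]
    ring

lemma bailey_sum {q : ℂ} (hq : ‖q‖ < 1) (N r : ℕ) (hr : r ≤ N) :
    ∑ s ∈ range (N + 1), q ^ (s ^ 2 + s) * pinv q (N - s) * bb q s r = q ^ (r ^ 2 + r) * bb q N r := by
  obtain ⟨n, rfl⟩ := Nat.exists_eq_add_of_le hr
  rw [add_assoc, sum_range_add, sum_eq_zero, zero_add]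
  · have h := gb_sum hq n (2 * r + 1)
    rw [bb, pp_add, show r + n + r + 1 = n + (2 * r + 1) by ring, ← h, mul_sum, mul_sum]
    refine sum_congr rfl fun j hj => ?_
    have hj : j ≤ n := by simpa [Nat.lt_succ_iff] using hj
    obtain ⟨k, rfl⟩ := Nat.exists_eq_add_of_le hj
    rw [gb_eq hq, pp_add, bb, pp_add, show r + (j + k) - (r + j) = k by omega,
      show r + j + r + 1 = j + (2 * r + 1) by ring]
    have : pinv q (j + k) * qPoch q q (j + k) = 1 := inv_mul_cancel₀ (qPoch_ne hq _)
    rw [show (r + j) ^ 2 + (r + j) = r ^ 2 + r + (j ^ 2 + (2 * r + 1) * j) by ring, pow_add q (r ^ 2 + r)]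
    linear_combination (-q ^ (r ^ 2 + r) * q ^ (j ^ 2 + (2 * r + 1) * j) * pinv q k * pinv q j *
      pinv q (j + (2 * r + 1))) * this
  · intro s hs
    rw [bb_gt q (by simpa using hs)]; ring

lemma bailey {q : ℂ} (hq : ‖q‖ < 1) (α β : ℕ → ℂ)
    (h : ∀ s, β s = ∑ r ∈ range (s + 1), α r * bb q s r) (N : ℕ) :
    ∑ s ∈ range (N + 1), q ^ (s ^ 2 + s) * pinv q (N - s) * β s =
      ∑ r ∈ range (N + 1), q ^ (r ^ 2 + r) * α r * bb q N r := by
  have h2 : ∀ s ∈ range (N + 1), q ^ (s ^ 2 + s) * pinv q (N - s) * β s =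
      ∑ r ∈ range (N + 1), α r * (q ^ (s ^ 2 + s) * pinv q (N - s) * bb q s r) := by
    intro s hs
    have : β s = ∑ r ∈ range (N + 1), α r * bb q s r := by
      rw [h]
      refine sum_subset (by intro x; simp at hs ⊢; omega) ?_
      intro x _ hx
      rw [bb_gt q (by simp at hx; omega)]; ring
    rw [this, mul_sum]
    refine sum_congr rfl fun r _ => by ring
  rw [sum_congr rfl h2, sum_comm]
  refine sum_congr rfl fun r hr => ?_
  rw [← mul_sum, bailey_sum hq N r (by simp at hr; omega)]
  ring

lemma cc_rel (q : ℂ) (r : ℕ) :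
    q ^ (r ^ 2 + r) * (q ^ (r ^ 2 + r) * cc q 1 r) = cc q (q ^ 4) r := by
  induction r with
  | zero => simp [cc]
  | succ r ih => rw [cc, cc, ← ih]; ring

lemma finite_rr {q : ℂ} (hq : ‖q‖ < 1) (N : ℕ) :
    ∑ s ∈ range (N + 1), (q ^ (s ^ 2 + s) / qPoch q q s) * pinv q (N - s) =
      ∑ r ∈ range (N + 1), dd q (q ^ 4) r * bb q N r := by
  have h1 : ∀ s : ℕ, (if s = 0 then (1 : ℂ) else 0) = ∑ r ∈ range (s + 1), dd q 1 r * bb q s r := by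
    intro s
    have := finite_jtp (z := q) (w := 1) (by simpa using hq) s
    rw [mul_one] at this
    rw [this]
    cases s with
    | zero =>
      have := pinv_step hq 0
      rw [pinv_zero] at this
      simp only [zero_add, pow_one] at this
      simp only [if_true, zero_add, mul_zero]
      rw [qPoch_succ, qPoch_zero, qPoch_zero]
      linear_combination this
    | succ s =>
      have : qPoch q 1 (s + 1) = 0 := by
        rw [qPoch, prod_eq_zero (i := 0)] <;> simp
      simp [this]
  have h2 : ∀ s, pinv q s = ∑ r ∈ range (s + 1), (q ^ (r ^ 2 + r) * dd q 1 r) * bb q s r := by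
    intro s
    rw [← bailey hq _ _ h1 s]
    rw [sum_eq_single 0]
    · simp
    · intro b _ hb; simp [hb]
    · simp
  have h3 := bailey hq _ _ h2 N
  have h4 : ∀ r, q ^ (r ^ 2 + r) * (q ^ (r ^ 2 + r) * dd q 1 r) = dd q (q ^ 4) r := by
    intro r
    rw [dd, dd, ← cc_rel]; ring
  simp only [h4] at h3
  rw [← h3]
  refine sum_congr rfl fun s _ => ?_
  rw [pinv, pinv, div_eq_mul_inv]; ring

open Filter Topology

lemma pow_five_norm {q : ℂ} (hq : ‖q‖ < 1) : ‖q ^ 5‖ < 1 := by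
  rw [norm_pow]; exact pow_lt_one₀ (norm_nonneg _) hq (by norm_num)

lemma poch_tendsto {q : ℂ} (hq : ‖q‖ < 1) (a : ℂ) (ha : ‖a‖ < 1) :
    ∃ A : ℂ, A ≠ 0 ∧ HasProd (fun i : ℕ => 1 - a * q ^ i) A ∧
      Tendsto (fun N => qPoch q a N) atTop (𝓝 A) := by
  have hs : Summable fun i : ℕ => ‖-(a * q ^ i)‖ := by
    simp only [norm_neg, norm_mul, norm_pow]
    exact (summable_geometric_of_lt_one (norm_nonneg _) hq).mul_left _
  have hm : Multipliable fun i : ℕ => 1 + -(a * q ^ i) := multipliable_one_add_of_summable hs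
  have hne : ∏' i : ℕ, (1 + -(a * q ^ i)) ≠ 0 := by
    refine tprod_one_add_ne_zero_of_summable ?_ hs
    intro i h
    have h1 : a * q ^ i = 1 := by linear_combination -h
    have h2 : ‖a‖ * ‖q‖ ^ i = 1 := by rw [← norm_pow, ← norm_mul, h1, norm_one]
    have h3 : ‖q‖ ^ i ≤ 1 := pow_le_one₀ (norm_nonneg _) hq.le
    nlinarith [norm_nonneg a, norm_nonneg q]
  simp only [← sub_eq_add_neg] at hm hne
  exact ⟨_, hne, hm.hasProd, hm.hasProd.tendsto_prod_nat⟩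

/-- Tannery-type lemma -/
lemma tannery (a : ℕ → ℂ) (ha : Summable fun n => ‖a n‖) (f : ℕ → ℕ → ℂ) (l : ℂ) (C : ℝ)
    (hb : ∀ N r, ‖f N r‖ ≤ C) (hf : ∀ r, Tendsto (fun N => f N r) atTop (𝓝 l)) :
    Tendsto (fun N => ∑ r ∈ range (N + 1), a r * f N r) atTop (𝓝 ((∑' n, a n) * l)) := by
  have h := tendsto_tsum_of_dominated_convergence (𝓕 := atTop)
    (f := fun N r => if r ∈ range (N + 1) then a r * f N r else 0)
    (g := fun r => a r * l) (bound := fun r => ‖a r‖ * C) (ha.mul_right C) ?_ ?_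
  · rw [tsum_mul_right] at h
    refine h.congr fun N => ?_
    rw [tsum_eq_sum (s := range (N + 1))]
    · exact sum_congr rfl fun r hr => by rw [if_pos hr]
    · intro r hr; rw [if_neg hr]
  · intro r
    refine ((hf r).const_mul (a r)).congr' ?_
    filter_upwards [eventually_ge_atTop r] with N hN
    rw [if_pos (by simp; omega)]
  · refine Eventually.of_forall fun N r => ?_
    have hC : 0 ≤ C := (norm_nonneg _).trans (hb 0 0)
    split_ifs
    · rw [norm_mul]; exact mul_le_mul_of_nonneg_left (hb N r) (norm_nonneg _)
    · rw [norm_zero]; positivity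

lemma pinv_bound {q : ℂ} (hq : ‖q‖ < 1) : ∃ C : ℝ, 0 ≤ C ∧ ∀ n, ‖pinv q n‖ ≤ C := by
  obtain ⟨A, hA, -, ht⟩ := poch_tendsto hq q hq
  obtain ⟨C, hC⟩ := (Metric.isBounded_range_of_tendsto _ (ht.inv₀ hA)).exists_norm_le
  have h : ∀ n, ‖pinv q n‖ ≤ C := fun n => hC _ ⟨n, rfl⟩
  exact ⟨C, (norm_nonneg _).trans (h 0), h⟩

lemma pp_bound {q : ℂ} {C : ℝ} (hC : 0 ≤ C) (h : ∀ n, ‖pinv q n‖ ≤ C) (N r : ℕ) :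
    ‖pp q N r‖ ≤ C := by
  unfold pp
  split_ifs
  · exact h _
  · simpa using hC

lemma pp_tendsto {q A : ℂ} (h : Tendsto (fun N => pinv q N) atTop (𝓝 A)) (r : ℕ) :
    Tendsto (fun N => pp q N r) atTop (𝓝 A) := by
  refine (h.comp (tendsto_sub_atTop_nat r)).congr' ?_
  filter_upwards [eventually_ge_atTop r] with N hN
  simp [pp, hN]

lemma bb_sum_tendsto {q A : ℂ} (hq : ‖q‖ < 1) (h : Tendsto (fun N => pinv q N) atTop (𝓝 A))
    (a : ℕ → ℂ) (ha : Summable fun n => ‖a n‖) :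
    Tendsto (fun N => ∑ r ∈ range (N + 1), a r * bb q N r) atTop (𝓝 ((∑' n, a n) * (A * A))) := by
  obtain ⟨C, hC0, hC⟩ := pinv_bound hq
  refine tannery a ha _ _ (C * C) (fun N r => ?_) fun r => ?_
  · rw [bb, norm_mul]
    exact mul_le_mul (pp_bound hC0 hC N r) (hC _) (norm_nonneg _) hC0
  · refine (pp_tendsto h r).mul ?_
    have := h.comp (tendsto_add_atTop_nat (r + 1))
    exact this

lemma cc_norm {q : ℂ} (hq : ‖q‖ < 1) (r : ℕ) : ‖cc q (q ^ 4) r‖ ≤ ‖q‖ ^ r := by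
  induction r with
  | zero => simp [cc]
  | succ r ih =>
    have : cc q (q ^ 4) (r + 1) = - (q ^ (5 * r + 3) * (q * cc q (q ^ 4) r)) := by
      rw [cc]; ring
    rw [this, norm_neg, norm_mul, norm_mul, norm_pow, pow_succ' ‖q‖ r]
    have h1 : ‖q‖ ^ (5 * r + 3) ≤ 1 := pow_le_one₀ (norm_nonneg _) hq.le
    calc _ ≤ 1 * (‖q‖ * ‖q‖ ^ r) := by gcongr
      _ = _ := one_mul _

lemma dd_summable {q : ℂ} (hq : ‖q‖ < 1) : Summable fun r => ‖dd q (q ^ 4) r‖ := by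
  refine Summable.of_nonneg_of_le (fun _ => norm_nonneg _) (fun r => ?_)
    ((summable_geometric_of_lt_one (norm_nonneg _) hq).mul_right 2)
  rw [dd, norm_mul]
  have h1 : ‖q‖ ^ (2 * r + 1) ≤ 1 := pow_le_one₀ (norm_nonneg _) hq.le
  have h2 : ‖1 - q ^ (2 * r + 1)‖ ≤ 2 := by
    refine (norm_sub_le _ _).trans ?_
    rw [norm_one, norm_pow]; linarith
  exact mul_le_mul (cc_norm hq r) h2 (norm_nonneg _) (by positivity)

lemma rr_summable {q : ℂ} (hq : ‖q‖ < 1) :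
    Summable fun n : ℕ => ‖q ^ (n ^ 2 + n) / qPoch q q n‖ := by
  obtain ⟨C, hC0, hC⟩ := pinv_bound hq
  refine Summable.of_nonneg_of_le (fun _ => norm_nonneg _) (fun r => ?_)
    ((summable_geometric_of_lt_one (norm_nonneg _) hq).mul_right C)
  rw [div_eq_mul_inv, norm_mul, norm_pow]
  exact mul_le_mul (pow_le_pow_of_le_one (norm_nonneg _) hq.le (by omega)) (hC r)
    (norm_nonneg _) (by positivity)

lemma qPoch_five (q : ℂ) (N : ℕ) : qPoch q q (5 * N) =
    qPoch (q ^ 5) q N * qPoch (q ^ 5) (q ^ 2) N * qPoch (q ^ 5) (q ^ 3) N *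
      qPoch (q ^ 5) (q ^ 4) N * qPoch (q ^ 5) (q ^ 5) N := by
  induction N with
  | zero => simp [qPoch]
  | succ N ih =>
    rw [show 5 * (N + 1) = 5 * N + 1 + 1 + 1 + 1 + 1 by ring]
    simp only [qPoch_succ, ih]
    ring

/-- The second Rogers–Ramanujan identity. -/
theorem rogers_ramanujan_second (q : ℂ) (hq : ‖q‖ < 1) :
    ∑' n : ℕ, q ^ (n ^ 2 + n) / qPoch q q n =
      ∏' n : ℕ, 1 / ((1 - q ^ (5 * n + 2)) * (1 - q ^ (5 * n + 3))) := by
  have h5 := pow_five_norm hq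
  have hpow : ∀ k : ℕ, ‖q ^ (k + 1)‖ < 1 := fun k => by
    rw [norm_pow]; exact pow_lt_one₀ (norm_nonneg _) hq (Nat.succ_ne_zero k)
  obtain ⟨P, hP, -, tP⟩ := poch_tendsto hq q hq
  obtain ⟨A1, hA1, -, t1⟩ := poch_tendsto h5 q hq
  obtain ⟨A2, hA2, p2, t2⟩ := poch_tendsto h5 (q ^ 2) (hpow 1)
  obtain ⟨A3, hA3, p3, t3⟩ := poch_tendsto h5 (q ^ 3) (hpow 2)
  obtain ⟨A4, hA4, -, t4⟩ := poch_tendsto h5 (q ^ 4) (hpow 3)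
  obtain ⟨A5, hA5, -, t5⟩ := poch_tendsto h5 (q ^ 5) (hpow 4)
  -- the right-hand side
  have hR : ∏' n : ℕ, 1 / ((1 - q ^ (5 * n + 2)) * (1 - q ^ (5 * n + 3))) = (A2 * A3)⁻¹ := by
    have := ((p2.mul p3).inv₀ (mul_ne_zero hA2 hA3)).tprod_eq
    rw [← this]
    refine tprod_congr fun n => ?_
    rw [one_div, ← pow_mul, ← pow_add, ← pow_add, add_comm 2, add_comm 3]
  -- the factorization of the Euler product
  have hF : P = A1 * A2 * A3 * A4 * A5 := by
    have ha := tP.comp (tendsto_id.const_mul_atTop' (show 0 < 5 by norm_num))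
    have hb := (((t1.mul t2).mul t3).mul t4).mul t5
    refine tendsto_nhds_unique ha (hb.congr fun N => ?_)
    exact (qPoch_five q N).symm
  -- the two limits of the finite identities
  have ti : Tendsto (fun N => pinv q N) atTop (𝓝 P⁻¹) := tP.inv₀ hP
  have ti5 : Tendsto (fun N => pinv (q ^ 5) N) atTop (𝓝 A5⁻¹) := t5.inv₀ hA5
  have hΘ := bb_sum_tendsto hq ti _ (dd_summable hq)
  have hΘ5 := bb_sum_tendsto h5 ti5 _ (dd_summable hq)
  have hL : Tendsto (fun N => ∑ s ∈ range (N + 1), (q ^ (s ^ 2 + s) / qPoch q q s) * pp q N s)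
      atTop (𝓝 ((∑' n : ℕ, q ^ (n ^ 2 + n) / qPoch q q n) * P⁻¹)) := by
    obtain ⟨C, hC0, hC⟩ := pinv_bound hq
    exact tannery _ (rr_summable hq) _ _ C (pp_bound hC0 hC) (pp_tendsto ti)
  have e1 : (∑' n : ℕ, q ^ (n ^ 2 + n) / qPoch q q n) * P⁻¹ =
      (∑' r, dd q (q ^ 4) r) * (P⁻¹ * P⁻¹) := by
    refine tendsto_nhds_unique hL (hΘ.congr fun N => ?_)
    rw [← finite_rr hq N]
    refine sum_congr rfl fun s hs => ?_
    rw [pp, if_pos (by simp at hs; omega)]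
  have e2 : (∑' r, dd q (q ^ 4) r) * (A5⁻¹ * A5⁻¹) = A1 * A4 * A5⁻¹ := by
    have hodd : Tendsto (fun N : ℕ => 2 * N + 1) atTop atTop :=
      tendsto_atTop_mono (fun N => by simp only [id]; omega) tendsto_id
    have hb := ((t1.comp (tendsto_add_atTop_nat 1)).mul t4).mul (ti5.comp hodd)
    refine tendsto_nhds_unique hΘ5 (hb.congr fun N => ?_)
    have hz : q * q ^ 4 = q ^ 5 := by ring
    have := finite_jtp (z := q) (w := q ^ 4) (by rw [hz]; exact h5) N
    rw [hz] at this
    exact this.symm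
  rw [hR]
  have e3 : (∑' r, dd q (q ^ 4) r) = A1 * A4 * A5 := by
    field_simp at e2
    linear_combination e2
  rw [e3, hF] at e1
  field_simp at e1 ⊢
  linear_combination e1
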